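/- arXiv:2103.15001 — 6 statements merged into one kernel-verified Lean document; each statement's English description precedes it below -/
import Mathlib

section
/- For the closed-loop dendritic trafficking model ṁ = (L − Ω_m)m + B·u, ġ = S·m − Ω_g·g, u̇ = k_G·([Ca]_target − ψ(cᵀg)) − γ_G·u, for any choice of the system parameters there exists a gain bound k̄_G > 0 such that for every 0 < k_G ≤ k̄_G the closed-loop system has an equilibrium (m*, g*, u*) and constants M ≥ 1, λ > 0 so that every solution whose g-component satisfies cᵀg(t) ≥ 0 for all t ≥ 0 obeys ‖(m(t), g(t), u(t)) − (m*, g*, u*)‖ ≤ M·e^{−λt}·‖(m(0), g(0), u(0)) − (m*, g*, u*)‖ for all t ≥ 0 (exponential stability of the equilibrium). -/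
open Filter

/-- Quasi-steady-state membrane potential. -/
noncomputable def Vss (gleak Eleak Eg G : ℝ) : ℝ :=
  (G * Eg + gleak * Eleak) / (gleak + G)

/-- The static calcium nonlinearity `ψ`. -/
noncomputable def psi (α β gleak Eleak Eg G : ℝ) : ℝ :=
  α / (1 + Real.exp (-(Vss gleak Eleak Eg G) / β))

/-- Right derivative of the absolute value along a differentiable function. -/
theorem aux_abs_deriv {x : ℝ → ℝ} {x' t : ℝ} (hx : HasDerivAt x x' t) (a r : ℝ)
    (h : x' = -a * x t + r) :
    ∃ d, d ≤ -a * |x t| + |r| ∧ HasDerivWithinAt (fun τ => |x τ|) d (Set.Ici t) t := by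
  rcases lt_trichotomy (x t) 0 with h0 | h0 | h0
  · refine ⟨-x', ?_, ?_⟩
    · rw [h, abs_of_neg h0]
      nlinarith [neg_abs_le r]
    · refine HasDerivAt.hasDerivWithinAt (hx.neg.congr_of_eventuallyEq ?_)
      filter_upwards [hx.continuousAt.eventually (gt_mem_nhds h0)] with τ hτ
      simp [abs_of_neg hτ]
  · refine ⟨|x'|, ?_, ?_⟩
    · rw [h, h0]; simp
    · rw [← hasDerivWithinAt_Ioi_iff_Ici, hasDerivWithinAt_iff_tendsto_slope' (by simp)]
      have h1 := hx.hasDerivWithinAt (s := Set.Ioi t)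
      rw [hasDerivWithinAt_iff_tendsto_slope' (by simp)] at h1
      refine h1.abs.congr' ?_
      filter_upwards [self_mem_nhdsWithin] with τ hτ
      have hτ' : 0 < τ - t := sub_pos.2 hτ
      simp [slope_def_field, h0, abs_div, abs_of_pos hτ']
  · refine ⟨x', ?_, ?_⟩
    · rw [h, abs_of_pos h0]
      nlinarith [le_abs_self r]
    · refine HasDerivAt.hasDerivWithinAt (hx.congr_of_eventuallyEq ?_)
      filter_upwards [hx.continuousAt.eventually (lt_mem_nhds h0)] with τ hτ
      simp [abs_of_pos hτ]

theorem aux_sig (x y : ℝ) :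
    |1 / (1 + Real.exp x) - 1 / (1 + Real.exp y)| ≤ |x - y| := by
  wlog hxy : x ≤ y generalizing x y
  · rw [abs_sub_comm, abs_sub_comm x y]
    exact this y x (le_of_not_ge hxy)
  have hx := Real.exp_pos x
  have hy := Real.exp_pos y
  have h1 : Real.exp y - Real.exp x ≤ Real.exp y * (y - x) := by
    have h2 := Real.add_one_le_exp (x - y)
    have h3 : Real.exp x = Real.exp y * Real.exp (x - y) := by
      rw [← Real.exp_add]; congr 1; ring
    rw [h3]; nlinarith
  have h4 := Real.exp_le_exp.2 hxy
  rw [abs_of_nonpos (sub_nonpos.2 hxy)]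
  have h5 : 1 / (1 + Real.exp x) - 1 / (1 + Real.exp y)
      = (Real.exp y - Real.exp x) / ((1 + Real.exp x) * (1 + Real.exp y)) := by
    field_simp; ring
  rw [h5, abs_of_nonneg (div_nonneg (by linarith) (by positivity)), div_le_iff₀ (by positivity)]
  have h6 : 0 ≤ y - x := by linarith
  nlinarith [mul_nonneg h6 hx.le, mul_nonneg h6 hy.le, mul_nonneg h6 (mul_pos hx hy).le]

theorem aux_psi_lip (α β gleak Eleak Eg : ℝ) (hgl : 0 < gleak) (hα : 0 < α) (hβ : 0 < β) :
    ∃ Λ, 0 < Λ ∧ ∀ G H, -gleak / 2 ≤ G → -gleak / 2 ≤ H →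
      |psi α β gleak Eleak Eg G - psi α β gleak Eleak Eg H| ≤ Λ * |G - H| := by
  refine ⟨α * ((4 * |Eleak - Eg| / gleak) / β) + 1, by positivity, fun G H hG hH => ?_⟩
  have pG : gleak / 2 ≤ gleak + G := by linarith
  have pH : gleak / 2 ≤ gleak + H := by linarith
  have qG : 0 < gleak + G := by linarith
  have qH : 0 < gleak + H := by linarith
  have h1 : |psi α β gleak Eleak Eg G - psi α β gleak Eleak Eg H|
      ≤ α * |-(Vss gleak Eleak Eg G) / β - -(Vss gleak Eleak Eg H) / β| := by
    have := aux_sig (-(Vss gleak Eleak Eg G) / β) (-(Vss gleak Eleak Eg H) / β)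
    calc _ = α * |1 / (1 + Real.exp (-(Vss gleak Eleak Eg G) / β))
              - 1 / (1 + Real.exp (-(Vss gleak Eleak Eg H) / β))| := by
            rw [← abs_of_pos hα, ← abs_mul, abs_of_pos hα]; unfold psi; congr 1; ring
      _ ≤ _ := by gcongr
  have h2 : -(Vss gleak Eleak Eg G) / β - -(Vss gleak Eleak Eg H) / β
      = (gleak * (Eleak - Eg)) * (G - H) / ((gleak + G) * (gleak + H)) / β := by
    unfold Vss; field_simp; ring
  have h3 : |-(Vss gleak Eleak Eg G) / β - -(Vss gleak Eleak Eg H) / β|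
      ≤ (4 * |Eleak - Eg| / gleak) / β * |G - H| := by
    rw [h2, abs_div, abs_div, abs_mul, abs_mul, abs_of_pos hgl, abs_of_pos hβ,
      abs_of_pos (mul_pos qG qH)]
    have h4 : gleak / 2 * (gleak / 2) ≤ (gleak + G) * (gleak + H) :=
      mul_le_mul pG pH (by positivity) qG.le
    calc _ ≤ gleak * |Eleak - Eg| * |G - H| / (gleak / 2 * (gleak / 2)) / β := by gcongr
      _ = _ := by field_simp; ring
  calc _ ≤ _ := h1
    _ ≤ α * ((4 * |Eleak - Eg| / gleak) / β * |G - H|) := by gcongr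
    _ ≤ _ := by nlinarith [abs_nonneg (G - H)]

theorem aux_psi_bd (α β gleak Eleak Eg G : ℝ) (hα : 0 < α) :
    0 ≤ psi α β gleak Eleak Eg G ∧ psi α β gleak Eleak Eg G ≤ α := by
  unfold psi
  have := Real.exp_pos (-(Vss gleak Eleak Eg G) / β)
  refine ⟨by positivity, div_le_self hα.le (by linarith)⟩

/-- Scalar equilibrium equation. -/
theorem aux_eq (α β gleak Eleak Eg CaT κ k γG : ℝ) (hgl : 0 < gleak) (hα : 0 < α)
    (hCa0 : 0 < CaT) (hCaα : CaT < α) (hγ : 0 < γG) (hk : 0 < k)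
    (hsm : |κ| * (k * α / γG) ≤ gleak / 2) :
    ∃ u, -gleak / 2 ≤ κ * u ∧ k * (CaT - psi α β gleak Eleak Eg (κ * u)) - γG * u = 0 := by
  set R := k * α / γG with hR
  have hRp : 0 < R := by positivity
  have hγR : γG * R = k * α := by rw [hR]; field_simp
  have hdom : ∀ u ∈ Set.Icc (-R) R, -gleak / 2 ≤ κ * u := by
    intro u hu
    have h1 : |κ * u| ≤ |κ| * R := by
      rw [abs_mul]; gcongr; exact abs_le.2 hu
    linarith [neg_abs_le (κ * u)]
  have hcont : ContinuousOn
      (fun u => k * (CaT - psi α β gleak Eleak Eg (κ * u)) - γG * u) (Set.Icc (-R) R) := by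
    have h1 : ContinuousOn (fun u => Vss gleak Eleak Eg (κ * u)) (Set.Icc (-R) R) := by
      unfold Vss
      refine ContinuousOn.div (by fun_prop) (by fun_prop) ?_
      intro u hu
      have := hdom u hu
      linarith
    have h2 : ContinuousOn (fun u => psi α β gleak Eleak Eg (κ * u)) (Set.Icc (-R) R) := by
      unfold psi
      refine ContinuousOn.div (by fun_prop) (by fun_prop) ?_
      intro u hu
      positivity
    fun_prop
  have hiv := intermediate_value_Icc' (by linarith : -R ≤ R) hcont
  obtain ⟨u, hu, h0⟩ := hiv (show (0:ℝ) ∈ _ by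
    have h1 := aux_psi_bd α β gleak Eleak Eg (κ * R) hα
    have h2 := aux_psi_bd α β gleak Eleak Eg (κ * -R) hα
    constructor
    · nlinarith
    · nlinarith)
  exact ⟨u, hdom u hu, h0⟩

theorem aux_inv {n : ℕ} (L : Matrix (Fin n) (Fin n) ℝ)
    (hL_off : ∀ i j, i ≠ j → 0 ≤ L i j) (hL_col : ∀ j, ∑ i, L i j = 0)
    (ωm : Fin n → ℝ) (hωm : ∀ i, 0 < ωm i) (e : Fin n → ℝ) :
    ∃ p, (L - Matrix.diagonal ωm).mulVec p + e = 0 := by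
  have hdet : (L - Matrix.diagonal ωm).det ≠ 0 := by
    apply det_ne_zero_of_sum_col_lt_diag
    intro k
    have h1 : ∑ i ∈ Finset.univ.erase k, ‖(L - Matrix.diagonal ωm) i k‖
        = ∑ i ∈ Finset.univ.erase k, L i k := by
      refine Finset.sum_congr rfl fun i hi => ?_
      have hik := Finset.ne_of_mem_erase hi
      simp [Matrix.diagonal_apply_ne _ hik, abs_of_nonneg (hL_off i k hik)]
    have h2 := Finset.add_sum_erase Finset.univ (fun i => L i k) (Finset.mem_univ k)
    rw [hL_col] at h2
    have h3 : 0 ≤ ∑ i ∈ Finset.univ.erase k, L i k :=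
      Finset.sum_nonneg fun i hi => hL_off i k (Finset.ne_of_mem_erase hi)
    rw [h1]
    simp only [Matrix.sub_apply, Matrix.diagonal_apply_eq, Real.norm_eq_abs]
    have := hωm k
    rw [abs_of_neg (by linarith)]
    linarith
  refine ⟨(L - Matrix.diagonal ωm)⁻¹.mulVec (-e), ?_⟩
  rw [Matrix.mulVec_mulVec, Matrix.mul_nonsing_inv _ (isUnit_iff_ne_zero.2 hdet)]
  simp

/-- Exponential decay from a right-derivative inequality. -/
theorem aux_decay (V : ℝ → ℝ) (lam : ℝ) (hc : ContinuousOn V (Set.Ici 0))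
    (h : ∀ t, 0 ≤ t → ∃ d, d ≤ -lam * V t ∧ HasDerivWithinAt V d (Set.Ici t) t) :
    ∀ t, 0 ≤ t → V t ≤ V 0 * Real.exp (-lam * t) := by
  intro t ht
  choose! d hd hd' using h
  have := le_gronwallBound_of_liminf_deriv_right_le (f := V) (f' := d) (δ := V 0) (K := -lam)
    (ε := 0) (a := 0) (b := t) (hc.mono Set.Icc_subset_Ici_self)
    (fun x hx r hr => (hd' x hx.1).liminf_right_slope_le hr) le_rfl
    (fun x hx => by simpa using hd x hx.1) t ⟨ht, le_rfl⟩
  simpa [gronwallBound_ε0] using this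

theorem aux_lower {n : ℕ} (hn : 0 < n) (f g : Fin n → ℝ) (hf : ∀ i, 0 < f i) (hg : ∀ i, 0 < g i) :
    ∃ ω, 0 < ω ∧ (∀ i, ω ≤ f i) ∧ (∀ i, ω ≤ g i) := by
  have : Nonempty (Fin n) := ⟨⟨0, hn⟩⟩
  obtain ⟨i, hi⟩ := Finite.exists_min f
  obtain ⟨j, hj⟩ := Finite.exists_min g
  exact ⟨min (f i) (g j), lt_min (hf i) (hg j), fun l => (min_le_left _ _).trans (hi l),
    fun l => (min_le_right _ _).trans (hj l)⟩

theorem aux_upper {n : ℕ} (f g : Fin n → ℝ) :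
    ∃ σ, 0 < σ ∧ (∀ i, f i ≤ σ) ∧ (∀ i, g i ≤ σ) := by
  refine ⟨‖f‖ + ‖g‖ + 1, by positivity, fun i => ?_, fun i => ?_⟩
  · have h1 := (le_abs_self (f i)).trans (norm_le_pi_norm f i)
    linarith [norm_nonneg g]
  · have h1 := (le_abs_self (g i)).trans (norm_le_pi_norm g i)
    linarith [norm_nonneg f]

/-- Decay of the weighted `ℓ¹` norm of the deviation from the equilibrium. -/
theorem aux_stab {n : ℕ} (i0 : Fin n) (L : Matrix (Fin n) (Fin n) ℝ)
    (hL_off : ∀ i j, i ≠ j → 0 ≤ L i j) (hL_col : ∀ j, ∑ i, L i j = 0)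
    (ωm ωg s c : Fin n → ℝ) (hs : ∀ i, 0 < s i) (hc : ∀ i, 0 ≤ c i)
    (γG ω σ a b Λ k lam : ℝ) (hωm : ∀ i, ω ≤ ωm i) (hωg : ∀ i, ω ≤ ωg i)
    (hsσ : ∀ i, s i ≤ σ) (hcσ : ∀ i, c i ≤ σ)
    (ha : 0 < a) (hb : 0 < b) (hΛ : 0 < Λ) (hk : 0 < k)
    (haσ : a * σ = ω / 2) (hbγ : b * γG = 2) (hsm : b * (k * Λ * σ) ≤ a * ω / 2)
    (hl1 : lam ≤ ω / 2) (hl2 : lam ≤ γG / 2)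
    (x y : ℝ → Fin n → ℝ) (w r : ℝ → ℝ)
    (hx : ∀ t, 0 ≤ t → HasDerivAt x ((L - Matrix.diagonal ωm).mulVec (x t)
      + w t • (Pi.single i0 1 : Fin n → ℝ)) t)
    (hy : ∀ t, 0 ≤ t → HasDerivAt y (fun i => s i * x t i - ωg i * y t i) t)
    (hw : ∀ t, 0 ≤ t → HasDerivAt w (r t - γG * w t) t)
    (hr : ∀ t, 0 ≤ t → |r t| ≤ k * (Λ * |∑ i, c i * y t i|)) :
    ∀ t, 0 ≤ t → ∑ i, |x t i| + a * ∑ i, |y t i| + b * |w t| ≤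
      (∑ i, |x 0 i| + a * ∑ i, |y 0 i| + b * |w 0|) * Real.exp (-lam * t) := by
  apply aux_decay (fun t => ∑ i, |x t i| + a * ∑ i, |y t i| + b * |w t|) lam
  · have h1 : ContinuousOn x (Set.Ici 0) :=
      fun t ht => (hx t ht).continuousAt.continuousWithinAt
    have h2 : ContinuousOn y (Set.Ici 0) :=
      fun t ht => (hy t ht).continuousAt.continuousWithinAt
    have h3 : ContinuousOn w (Set.Ici 0) :=
      fun t ht => (hw t ht).continuousAt.continuousWithinAt
    fun_prop
  intro t ht
  have Hx : ∀ i, ∃ d, d ≤ ∑ j, L i j * |x t j| - ωm i * |x t i|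
      + |w t| * (Pi.single i0 1 : Fin n → ℝ) i
      ∧ HasDerivWithinAt (fun τ => |x τ i|) d (Set.Ici t) t := by
    intro i
    obtain ⟨d, hd, hd'⟩ := aux_abs_deriv (hasDerivAt_pi.1 (hx t ht) i) (ωm i - L i i)
      (∑ j ∈ Finset.univ.erase i, L i j * x t j + w t * (Pi.single i0 1 : Fin n → ℝ) i) (by
        have h2 := Finset.add_sum_erase Finset.univ (fun j => L i j * x t j) (Finset.mem_univ i)
        simp only [Pi.add_apply, Pi.smul_apply, smul_eq_mul, Matrix.sub_mulVec, Pi.sub_apply,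
          Matrix.mulVec_diagonal]
        simp only [Matrix.mulVec, dotProduct]
        rw [← h2]; ring)
    refine ⟨d, hd.trans ?_, hd'⟩
    have h2 := Finset.add_sum_erase Finset.univ (fun j => L i j * |x t j|) (Finset.mem_univ i)
    rw [← h2]
    have h3 : |∑ j ∈ Finset.univ.erase i, L i j * x t j|
        ≤ ∑ j ∈ Finset.univ.erase i, L i j * |x t j| := by
      refine (Finset.abs_sum_le_sum_abs _ _).trans (Finset.sum_le_sum fun j hj => ?_)
      rw [abs_mul, abs_of_nonneg (hL_off i j (Finset.ne_of_mem_erase hj).symm)]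
    have h4 : |w t * (Pi.single i0 1 : Fin n → ℝ) i|
        = |w t| * (Pi.single i0 1 : Fin n → ℝ) i := by
      rw [abs_mul]; congr 1
      by_cases h : i = i0
      · subst h; simp
      · simp [h]
    have h5 := abs_add_le (∑ j ∈ Finset.univ.erase i, L i j * x t j)
      (w t * (Pi.single i0 1 : Fin n → ℝ) i)
    rw [h4] at h5
    linarith
  have Hy : ∀ i, ∃ d, d ≤ -ωg i * |y t i| + s i * |x t i|
      ∧ HasDerivWithinAt (fun τ => |y τ i|) d (Set.Ici t) t := by
    intro i
    obtain ⟨d, hd, hd'⟩ := aux_abs_deriv (hasDerivAt_pi.1 (hy t ht) i) (ωg i)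
      (s i * x t i) (by ring)
    refine ⟨d, hd.trans ?_, hd'⟩
    rw [abs_mul, abs_of_pos (hs i)]
  obtain ⟨dw, hdw, hdw'⟩ := aux_abs_deriv (hw t ht) γG (r t) (by ring)
  choose dx hdx hdx' using Hx
  choose dy hdy hdy' using Hy
  refine ⟨∑ i, dx i + a * ∑ i, dy i + b * dw, ?_, ?_⟩
  · have e1 : ∑ i, dx i ≤ -ω * ∑ i, |x t i| + |w t| := by
      calc _ ≤ ∑ i, (∑ j, L i j * |x t j| - ωm i * |x t i|
              + |w t| * (Pi.single i0 1 : Fin n → ℝ) i) := Finset.sum_le_sum fun i _ => hdx i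
        _ = - ∑ i, ωm i * |x t i| + |w t| := by
            rw [Finset.sum_add_distrib, Finset.sum_sub_distrib, Finset.sum_comm,
              ← Finset.mul_sum]
            simp [← Finset.sum_mul, hL_col]
        _ ≤ _ := by
            have : ω * ∑ i, |x t i| ≤ ∑ i, ωm i * |x t i| := by
              rw [Finset.mul_sum]
              exact Finset.sum_le_sum fun i _ =>
                mul_le_mul_of_nonneg_right (hωm i) (abs_nonneg _)
            linarith
    have e2 : ∑ i, dy i ≤ -ω * ∑ i, |y t i| + σ * ∑ i, |x t i| := by
      rw [Finset.mul_sum, Finset.mul_sum, ← Finset.sum_add_distrib]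
      refine Finset.sum_le_sum fun i _ => (hdy i).trans ?_
      have h1 := mul_le_mul_of_nonneg_right (hωg i) (abs_nonneg (y t i))
      have h2 := mul_le_mul_of_nonneg_right (hsσ i) (abs_nonneg (x t i))
      linarith
    have e3 : |∑ i, c i * y t i| ≤ σ * ∑ i, |y t i| := by
      rw [Finset.mul_sum]
      refine (Finset.abs_sum_le_sum_abs _ _).trans (Finset.sum_le_sum fun i _ => ?_)
      rw [abs_mul, abs_of_nonneg (hc i)]
      exact mul_le_mul_of_nonneg_right (hcσ i) (abs_nonneg _)
    have e4 : |r t| ≤ k * (Λ * (σ * ∑ i, |y t i|)) := (hr t ht).trans (by gcongr)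
    have X0 : 0 ≤ ∑ i, |x t i| := Finset.sum_nonneg fun i _ => abs_nonneg _
    have Y0 : 0 ≤ ∑ i, |y t i| := Finset.sum_nonneg fun i _ => abs_nonneg _
    have W0 := abs_nonneg (w t)
    generalize (∑ i, |x t i|) = X at *
    generalize (∑ i, |y t i|) = Y at *
    generalize |w t| = W at *
    have f2 := mul_le_mul_of_nonneg_left e2 ha.le
    have f3 := mul_le_mul_of_nonneg_left (hdw.trans (add_le_add_right e4 _)) hb.le
    have f4 := mul_le_mul_of_nonneg_right hsm Y0
    have f5 : a * σ * X = ω / 2 * X := by rw [haσ]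
    have f6 : b * γG * W = 2 * W := by rw [hbγ]
    have g1 := mul_le_mul_of_nonneg_right hl1 X0
    have g2 := mul_le_mul_of_nonneg_right hl1 (mul_nonneg ha.le Y0)
    have g3 := mul_le_mul_of_nonneg_right hl2 (mul_nonneg hb.le W0)
    linarith
  · have i1 : HasDerivWithinAt (fun τ => ∑ i, |x τ i|) (∑ i, dx i) (Set.Ici t) t :=
      HasDerivWithinAt.fun_sum fun i _ => hdx' i
    have i2 : HasDerivWithinAt (fun τ => ∑ i, |y τ i|) (∑ i, dy i) (Set.Ici t) t :=
      HasDerivWithinAt.fun_sum fun i _ => hdy' i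
    exact (i1.add (i2.const_mul a)).add (hdw'.const_mul b)

/-- Comparison of the weighted `ℓ¹` norm with the product norm. -/
theorem aux_norm {n : ℕ} (a b : ℝ) (ha : 0 < a) (hb : 0 < b) :
    ∃ C D, 0 < C ∧ 0 < D ∧ ∀ (x y : Fin n → ℝ) (w : ℝ),
      ‖(x, y, w)‖ ≤ C * (∑ i, |x i| + a * ∑ i, |y i| + b * |w|) ∧
      ∑ i, |x i| + a * ∑ i, |y i| + b * |w| ≤ D * ‖(x, y, w)‖ := by
  have key : ∀ z : Fin n → ℝ, ‖z‖ ≤ ∑ i, |z i| := fun z =>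
    (pi_norm_le_iff_of_nonneg (Finset.sum_nonneg fun i _ => abs_nonneg _)).2 fun i =>
      Finset.single_le_sum (f := fun i => |z i|) (fun i _ => abs_nonneg _) (Finset.mem_univ i)
  have key2 : ∀ z : Fin n → ℝ, ∑ i, |z i| ≤ n * ‖z‖ := fun z => by
    calc _ ≤ ∑ _i : Fin n, ‖z‖ := Finset.sum_le_sum fun i _ => norm_le_pi_norm z i
      _ = _ := by simp
  refine ⟨1 + 1 / a + 1 / b, n + a * n + b, by positivity, by positivity, fun x y w => ?_⟩
  have X0 : 0 ≤ ∑ i, |x i| := Finset.sum_nonneg fun i _ => abs_nonneg _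
  have Y0 : 0 ≤ ∑ i, |y i| := Finset.sum_nonneg fun i _ => abs_nonneg _
  constructor
  · have hV : 0 ≤ ∑ i, |x i| + a * ∑ i, |y i| + b * |w| := by positivity
    have hE : (1 + 1 / a + 1 / b) * (∑ i, |x i| + a * ∑ i, |y i| + b * |w|)
      = ∑ i, |x i| + ∑ i, |y i| + |w| + (a * ∑ i, |y i| + b * |w|)
        + (∑ i, |x i| + b * |w|) / a + (∑ i, |x i| + a * ∑ i, |y i|) / b := by
      field_simp; ring
    have h1 : 0 ≤ (∑ i, |x i| + b * |w|) / a := by positivity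
    have h2 : 0 ≤ (∑ i, |x i| + a * ∑ i, |y i|) / b := by positivity
    have h3 : 0 ≤ a * ∑ i, |y i| + b * |w| := by positivity
    have h4 := abs_nonneg w
    rw [hE]
    refine norm_prod_le_iff.2 ⟨?_, norm_prod_le_iff.2 ⟨?_, ?_⟩⟩
    · have := key x
      simp only
      linarith
    · have := key y
      simp only
      linarith
    · simp only [Real.norm_eq_abs]
      linarith
  · have h0 : ‖x‖ ≤ ‖(x, y, w)‖ := norm_fst_le (x, y, w)
    have h1 : ‖(y, w)‖ ≤ ‖(x, y, w)‖ := norm_snd_le (x, y, w)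
    have h2 : ‖y‖ ≤ ‖(x, y, w)‖ := (norm_fst_le (y, w)).trans h1
    have h3 : |w| ≤ ‖(x, y, w)‖ := (norm_snd_le (y, w)).trans h1
    calc _ ≤ n * ‖(x, y, w)‖ + a * (n * ‖(x, y, w)‖) + b * ‖(x, y, w)‖ := by
          gcongr
          · exact (key2 x).trans (by gcongr)
          · exact (key2 y).trans (by gcongr)
      _ = _ := by ring

/-- global exponential stability of the closed-loop dendritic
trafficking model for sufficiently small global feedback gain. -/
theorem global_homeostasis_stability
    {n : ℕ} (hn : 0 < n)
    (L : Matrix (Fin n) (Fin n) ℝ)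
    (hL_off : ∀ i j, i ≠ j → 0 ≤ L i j)
    (hL_col : ∀ j, ∑ i, L i j = 0)
    (hL_sym : ∀ i j, i ≠ j → (L i j ≠ 0 ↔ L j i ≠ 0))
    (hL_conn : ∀ i j : Fin n, i ≠ j → Relation.TransGen (fun a b => 0 < L b a) i j)
    (ωm ωg s : Fin n → ℝ)
    (hωm : ∀ i, 0 < ωm i) (hωg : ∀ i, 0 < ωg i) (hs : ∀ i, 0 < s i)
    (c : Fin n → ℝ) (hc : ∀ i, 0 ≤ c i) (hc0 : c ≠ 0)
    (γG gleak α β Eleak Eg CaT : ℝ)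
    (hγ : 0 < γG) (hgl : 0 < gleak) (hα : 0 < α) (hβ : 0 < β)
    (hCa0 : 0 < CaT) (hCaα : CaT < α)
    (hfeas : Eg + β * Real.log (α / CaT) ≠ 0) :
    ∃ kbar : ℝ, 0 < kbar ∧ ∀ kG : ℝ, 0 < kG → kG ≤ kbar →
      ∃ (mstar gstar : Fin n → ℝ) (ustar : ℝ),
        -- equilibrium equations
        ((L - Matrix.diagonal ωm).mulVec mstar
            + ustar • (Pi.single (⟨0, hn⟩ : Fin n) 1 : Fin n → ℝ) = 0 ∧
         (∀ i, s i * mstar i - ωg i * gstar i = 0) ∧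
         kG * (CaT - psi α β gleak Eleak Eg (∑ i, c i * gstar i)) - γG * ustar = 0) ∧
        -- exponential stability of the equilibrium
        ∃ M : ℝ, 1 ≤ M ∧ ∃ lam : ℝ, 0 < lam ∧
          ∀ (m g : ℝ → Fin n → ℝ) (u : ℝ → ℝ),
            (∀ t, 0 ≤ t → HasDerivAt m
              ((L - Matrix.diagonal ωm).mulVec (m t)
                + u t • (Pi.single (⟨0, hn⟩ : Fin n) 1 : Fin n → ℝ)) t) →
            (∀ t, 0 ≤ t → HasDerivAt g (fun i => s i * m t i - ωg i * g t i) t) →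
            (∀ t, 0 ≤ t → HasDerivAt u
              (kG * (CaT - psi α β gleak Eleak Eg (∑ i, c i * g t i)) - γG * u t) t) →
            (∀ t, 0 ≤ t → 0 ≤ ∑ i, c i * g t i) →
            ∀ t, 0 ≤ t →
              ‖(m t - mstar, g t - gstar, u t - ustar)‖ ≤
                M * Real.exp (-lam * t) * ‖(m 0 - mstar, g 0 - gstar, u 0 - ustar)‖ := by
  classical
  obtain ⟨Λ, hΛ, hlip⟩ := aux_psi_lip α β gleak Eleak Eg hgl hα hβ
  obtain ⟨p, hp⟩ := aux_inv L hL_off hL_col ωm hωm (Pi.single (⟨0, hn⟩ : Fin n) 1)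
  set κ : ℝ := ∑ i, c i * (s i / ωg i * p i) with hκ
  obtain ⟨ω, hω, hωm', hωg'⟩ := aux_lower hn ωm ωg hωm hωg
  obtain ⟨σ, hσ, hs', hc'⟩ := aux_upper s c
  set a : ℝ := ω / (2 * σ) with ha
  have hap : 0 < a := by positivity
  have haσ : a * σ = ω / 2 := by rw [ha]; field_simp
  set b : ℝ := 2 / γG with hb
  have hbp : 0 < b := by positivity
  have hbγ : b * γG = 2 := by rw [hb]; field_simp
  set k1 : ℝ := a * ω / (2 * (b * Λ * σ)) with hk1
  have hk1p : 0 < k1 := by positivity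
  have hk1e : b * (k1 * Λ * σ) = a * ω / 2 := by rw [hk1]; field_simp
  set k2 : ℝ := (gleak / 2) / ((|κ| + 1) * (α / γG)) with hk2
  have hk2p : 0 < k2 := by positivity
  have hk2e : (|κ| + 1) * (k2 * α / γG) = gleak / 2 := by rw [hk2]; field_simp
  refine ⟨min k1 k2, lt_min hk1p hk2p, fun k hk hkle => ?_⟩
  have hkk1 : k ≤ k1 := hkle.trans (min_le_left _ _)
  have hkk2 : k ≤ k2 := hkle.trans (min_le_right _ _)
  have hsm : |κ| * (k * α / γG) ≤ gleak / 2 := by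
    rw [← hk2e]; gcongr; linarith
  have hsm2 : b * (k * Λ * σ) ≤ a * ω / 2 := by
    rw [← hk1e]; gcongr
  obtain ⟨u0, hu0, hu0e⟩ :=
    aux_eq α β gleak Eleak Eg CaT κ k γG hgl hα hCa0 hCaα hγ hk hsm
  have hG : ∑ i, c i * (s i / ωg i * (u0 * p i)) = κ * u0 := by
    rw [hκ, Finset.sum_mul]; exact Finset.sum_congr rfl fun i _ => by ring
  have heq1 : (L - Matrix.diagonal ωm).mulVec (fun i => u0 * p i)
            + u0 • (Pi.single (⟨0, hn⟩ : Fin n) 1 : Fin n → ℝ) = 0 := by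
    have : (fun i => u0 * p i) = u0 • p := rfl
    rw [this, Matrix.mulVec_smul, ← smul_add, hp, smul_zero]
  have heq2 : ∀ i, s i * (u0 * p i) - ωg i * (s i / ωg i * (u0 * p i)) = 0 := by
    intro i; have := (hωg i).ne'; field_simp; ring
  refine ⟨fun i => u0 * p i, fun i => s i / ωg i * (u0 * p i), u0, ⟨heq1, heq2, ?_⟩, ?_⟩
  · rw [hG]; exact hu0e
  obtain ⟨C, D, hC, hD, hCD⟩ := aux_norm (n := n) a b hap hbp
  refine ⟨max 1 (C * D), le_max_left _ _, min (ω / 2) (γG / 2),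
    lt_min (by positivity) (by positivity), fun m g u hm hg hu hpos t ht => ?_⟩
  set lam := min (ω / 2) (γG / 2) with hlam
  set ms : Fin n → ℝ := fun i => u0 * p i with hms
  set gs : Fin n → ℝ := fun i => s i / ωg i * (u0 * p i) with hgs
  have hst := aux_stab ⟨0, hn⟩ L hL_off hL_col ωm ωg s c hs hc γG ω σ a b Λ k lam hωm' hωg'
    hs' hc' hap hbp hΛ hk haσ hbγ hsm2 (min_le_left _ _) (min_le_right _ _)
    (fun t => m t - ms) (fun t => g t - gs) (fun t => u t - u0)
    (fun t => k * (psi α β gleak Eleak Eg (κ * u0)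
      - psi α β gleak Eleak Eg (∑ i, c i * g t i)))
    (fun t ht => by
      refine HasDerivAt.congr_deriv ((hm t ht).sub_const ms) ?_
      rw [Matrix.mulVec_sub, sub_smul, sub_add_sub_comm, heq1, sub_zero])
    (fun t ht => by
      refine HasDerivAt.congr_deriv ((hg t ht).sub_const gs) ?_
      funext i
      have := heq2 i
      simp only [Pi.sub_apply, hms, hgs]
      linarith)
    (fun t ht => by
      refine HasDerivAt.congr_deriv ((hu t ht).sub_const u0) ?_
      linarith)
    (fun t ht => by
      rw [abs_mul, abs_of_pos hk]
      have h1 := hlip (κ * u0) (∑ i, c i * g t i) hu0 (by linarith [hpos t ht])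
      have h2 : |κ * u0 - ∑ i, c i * g t i| = |∑ i, c i * (g t - gs) i| := by
        rw [abs_sub_comm, ← hG, ← Finset.sum_sub_distrib]
        congr 1
        exact Finset.sum_congr rfl fun i _ => by simp only [Pi.sub_apply, hgs]; ring
      rw [h2] at h1
      gcongr) t ht
  have hE := Real.exp_pos (-lam * t)
  calc _ ≤ _ := (hCD _ _ _).1
    _ ≤ C * ((D * ‖(m 0 - ms, g 0 - gs, u 0 - u0)‖) * Real.exp (-lam * t)) := by
        refine mul_le_mul_of_nonneg_left (hst.trans ?_) hC.le
        exact mul_le_mul_of_nonneg_right (hCD _ _ _).2 hE.le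
    _ = (C * D) * Real.exp (-lam * t) * ‖(m 0 - ms, g 0 - gs, u 0 - u0)‖ := by ring
    _ ≤ _ := by gcongr; exact le_max_right _ _
end

section
/- For every ρ > 0 there exists a diagonal matrix P ∈ ℝ^{n×n} with strictly positive diagonal entries such that (L − ρI)ᵀP + P(L − ρI) is negative definite. -/
open Matrix

/-- A matrix with nonnegative off-diagonal entries and column sums `-ρ < 0` admits a positive
vector `v` with `A v = -1`. -/
lemma exists_pos_vec {n : ℕ} (A : Matrix (Fin n) (Fin n) ℝ) (ρ : ℝ) (hρ : 0 < ρ)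
    (hoff : ∀ i j, i ≠ j → 0 ≤ A i j) (hcol : ∀ j, ∑ i, A i j = -ρ) :
    ∃ v : Fin n → ℝ, (∀ i, 0 < v i) ∧ ∀ i, ∑ j, A i j * v j = -1 := by
  have hdet : A.det ≠ 0 := by
    apply det_ne_zero_of_sum_col_lt_diag
    intro k
    have h1 : ∑ i ∈ Finset.univ.erase k, ‖A i k‖ = ∑ i ∈ Finset.univ.erase k, A i k := by
      apply Finset.sum_congr rfl
      intro i hi
      exact Real.norm_of_nonneg (hoff i k (Finset.ne_of_mem_erase hi))
    have h2 := Finset.add_sum_erase Finset.univ (fun i => A i k) (Finset.mem_univ k)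
    have h3 := hcol k
    have h4 : -A k k ≤ ‖A k k‖ := neg_le_abs (A k k)
    rw [h1]
    linarith
  obtain ⟨v, hv⟩ : ∃ v, A *ᵥ v = fun _ => -1 :=
    ⟨A⁻¹ *ᵥ (fun _ => -1), by
      rw [Matrix.mulVec_mulVec, Matrix.mul_nonsing_inv _ (isUnit_iff_ne_zero.mpr hdet),
        Matrix.one_mulVec]⟩
  have hv' : ∀ i, ∑ j, A i j * v j = -1 := fun i => congrFun hv i
  refine ⟨v, ?_, hv'⟩
  by_contra! hcon
  obtain ⟨k, hk⟩ := hcon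
  set N := Finset.univ.filter (fun i => v i ≤ 0) with hN
  have hkN : k ∈ N := by simp [hN, hk]
  have hneg : ∑ i ∈ N, ∑ j, A i j * v j < 0 := by
    rw [Finset.sum_congr rfl (fun i _ => hv' i)]
    have : 0 < N.card := Finset.card_pos.mpr ⟨k, hkN⟩
    simp [this]
  have hnonneg : 0 ≤ ∑ i ∈ N, ∑ j, A i j * v j := by
    rw [Finset.sum_comm]
    apply Finset.sum_nonneg
    intro j _
    rw [← Finset.sum_mul]
    by_cases hj : v j ≤ 0
    · apply mul_nonneg_of_nonpos_of_nonpos _ hj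
      have h1 : ∑ i ∈ N, A i j + ∑ i ∈ Nᶜ, A i j = -ρ := by
        rw [Finset.sum_add_sum_compl, hcol]
      have h2 : 0 ≤ ∑ i ∈ Nᶜ, A i j := by
        apply Finset.sum_nonneg
        intro i hi
        apply hoff
        rintro rfl
        simp [hN] at hi
        linarith
      linarith
    · push Not at hj
      apply mul_nonneg _ hj.le
      apply Finset.sum_nonneg
      intro i hi
      apply hoff
      rintro rfl
      simp [hN] at hi
      linarith
  linarith

/-- for every `ρ > 0` there is a positive diagonal matrix `P`
such that `(L - ρI)ᵀ P + P (L - ρI)` is negative definite. -/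
theorem diagonal_lyapunov_matrix
    {n : ℕ} (hn : 0 < n)
    (L : Matrix (Fin n) (Fin n) ℝ)
    (hL_off : ∀ i j, i ≠ j → 0 ≤ L i j)
    (hL_col : ∀ j, ∑ i, L i j = 0)
    (hL_sym : ∀ i j, i ≠ j → (L i j ≠ 0 ↔ L j i ≠ 0))
    (hL_conn : ∀ i j : Fin n, i ≠ j → Relation.TransGen (fun a b => 0 < L b a) i j) :
    ∀ ρ : ℝ, 0 < ρ →
      ∃ p : Fin n → ℝ, (∀ i, 0 < p i) ∧
        (-((L - ρ • (1 : Matrix (Fin n) (Fin n) ℝ))ᵀ * Matrix.diagonal p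
            + Matrix.diagonal p * (L - ρ • (1 : Matrix (Fin n) (Fin n) ℝ)))).PosDef := by
  intro ρ hρ
  have hoff : ∀ i j, i ≠ j → 0 ≤ (L - ρ • (1 : Matrix (Fin n) (Fin n) ℝ)) i j := by
    intro i j hij
    simpa [Matrix.one_apply, hij] using hL_off i j hij
  have hcol : ∀ j, ∑ i, (L - ρ • (1 : Matrix (Fin n) (Fin n) ℝ)) i j = -ρ := by
    intro j
    simp [Matrix.one_apply, Finset.sum_sub_distrib, hL_col]
  generalize (L - ρ • (1 : Matrix (Fin n) (Fin n) ℝ)) = A at hoff hcol ⊢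
  obtain ⟨v, hvpos, hv⟩ := exists_pos_vec A ρ hρ hoff hcol
  refine ⟨fun i => (v i)⁻¹, fun i => inv_pos.mpr (hvpos i), ?_⟩
  apply Matrix.PosDef.of_dotProduct_mulVec_pos
  · apply Matrix.IsHermitian.ext
    intro i j
    simp [Matrix.mul_diagonal, Matrix.diagonal_mul]
    ring
  · intro x hx
    obtain ⟨k, hk⟩ := Function.ne_iff.mp hx
    simp only [Pi.zero_apply] at hk
    have hquad : star x ⬝ᵥ (-(Aᵀ * Matrix.diagonal (fun i => (v i)⁻¹)
        + Matrix.diagonal (fun i => (v i)⁻¹) * A)) *ᵥ x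
        = -(2 * ∑ i, ∑ j, A i j * v j * (x i / v i) * (x j / v j)) := by
      have e1 : ∀ i j, A i j * v j * (x i / v i) * (x j / v j)
          = x i * ((v i)⁻¹ * A i j * x j) := by
        intro i j
        have := (hvpos j).ne'
        field_simp
      simp only [e1]
      rw [Matrix.neg_mulVec, Matrix.add_mulVec, dotProduct_neg, dotProduct_add, two_mul]
      congr 2
      · rw [Finset.sum_comm]
        simp only [dotProduct, mulVec, Matrix.mul_diagonal, Finset.mul_sum, star_trivial,
          Matrix.transpose_apply]
        refine Finset.sum_congr rfl fun i _ => Finset.sum_congr rfl fun j _ => ?_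
        ring
      · simp only [dotProduct, mulVec, Matrix.diagonal_mul, Finset.mul_sum, star_trivial]
    rw [hquad]
    have hle : ∑ i, ∑ j, A i j * v j * (x i / v i) * (x j / v j)
        ≤ ∑ i, ∑ j, A i j * v j * (((x i / v i) ^ 2 + (x j / v j) ^ 2) / 2) := by
      refine Finset.sum_le_sum fun i _ => Finset.sum_le_sum fun j _ => ?_
      by_cases hij : i = j
      · subst hij
        apply le_of_eq
        ring
      · have h0 := mul_nonneg (hoff i j hij) (hvpos j).le
        have := mul_nonneg h0 (sq_nonneg (x i / v i - x j / v j))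
        nlinarith
    have heq : ∑ i, ∑ j, A i j * v j * (((x i / v i) ^ 2 + (x j / v j) ^ 2) / 2)
        = -((∑ i, (x i / v i) ^ 2) + ρ * ∑ j, v j * (x j / v j) ^ 2) / 2 := by
      have e : ∀ i j, A i j * v j * (((x i / v i) ^ 2 + (x j / v j) ^ 2) / 2)
          = (A i j * v j) * ((x i / v i) ^ 2 / 2) + A i j * (v j * (x j / v j) ^ 2 / 2) := by
        intro i j; ring
      simp only [e, Finset.sum_add_distrib]
      rw [Finset.sum_comm (f := fun i j => A i j * (v j * (x j / v j) ^ 2 / 2))]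
      simp only [← Finset.sum_mul, hv, hcol]
      simp only [← Finset.mul_sum, ← Finset.sum_div]
      ring
    have h1 : 0 < ∑ i, (x i / v i) ^ 2 := by
      apply Finset.sum_pos' (fun i _ => sq_nonneg _)
      exact ⟨k, Finset.mem_univ k, sq_pos_of_ne_zero (div_ne_zero hk (hvpos k).ne')⟩
    have h2 : 0 ≤ ρ * ∑ j, v j * (x j / v j) ^ 2 :=
      mul_nonneg hρ.le (Finset.sum_nonneg fun j _ => mul_nonneg (hvpos j).le (sq_nonneg _))
    linarith
end

section
/- Assume g_leak > 0 and α, β > 0. The calcium map ψ(G) = α/(1 + exp(−V_ss(G)/β)), where V_ss(G) = (G·E_g + g_leak·E_leak)/(g_leak + G), is continuously differentiable on (−g_leak, ∞), and for every G ≥ 0 its derivative satisfies |ψ′(G)| ≤ α·|E_g − E_leak| / (4·β·g_leak). In particular ψ is Lipschitz on [0, ∞). -/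
theorem psi_hasDerivAt_aux (gleak Eleak Eg α β G : ℝ)
    (hβ : 0 < β) (hG : 0 < gleak + G) :
    HasDerivAt (psi α β gleak Eleak Eg)
      (α * (Eg - Eleak) / β * (gleak / (gleak + G) ^ 2) *
        (Real.exp (-(Vss gleak Eleak Eg G) / β) /
          (1 + Real.exp (-(Vss gleak Eleak Eg G) / β)) ^ 2)) G := by
  have hV : HasDerivAt (Vss gleak Eleak Eg)
      ((Eg - Eleak) * (gleak / (gleak + G) ^ 2)) G := by
    have h1 : HasDerivAt (fun x : ℝ => x * Eg + gleak * Eleak) (1 * Eg) G :=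
      ((hasDerivAt_id G).mul_const Eg).add_const _
    have h2 : HasDerivAt (fun x : ℝ => gleak + x) 1 G := (hasDerivAt_id G).const_add _
    have h3 := h1.div h2 hG.ne'
    refine h3.congr_deriv ?_
    field_simp
    ring
  have hE := ((hV.neg.div_const β).exp).const_add 1
  have hpos : (1 + Real.exp (-(Vss gleak Eleak Eg G) / β)) ≠ 0 := by positivity
  have h := (hasDerivAt_const G α).div hE hpos
  refine h.congr_deriv ?_
  simp only [Pi.neg_apply]
  generalize Real.exp (-(Vss gleak Eleak Eg G) / β) = e at *
  field_simp
  ring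

theorem psi_deriv_le_aux (gleak Eleak Eg α β G : ℝ)
    (hgl : 0 < gleak) (hα : 0 < α) (hβ : 0 < β) (hG : 0 ≤ G) :
    |deriv (psi α β gleak Eleak Eg) G| ≤ α * |Eg - Eleak| / (4 * β * gleak) := by
  have hp : 0 < gleak + G := by linarith
  rw [(psi_hasDerivAt_aux gleak Eleak Eg α β G hβ hp).deriv]
  have he := Real.exp_pos (-(Vss gleak Eleak Eg G) / β)
  generalize Real.exp (-(Vss gleak Eleak Eg G) / β) = e at *
  have h1 : gleak / (gleak + G) ^ 2 ≤ 1 / gleak := by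
    rw [div_le_div_iff₀ (by positivity) hgl]
    nlinarith [mul_nonneg hgl.le hG]
  have h2 : e / (1 + e) ^ 2 ≤ 1 / 4 := by
    rw [div_le_div_iff₀ (by positivity) (by norm_num)]
    nlinarith [sq_nonneg (1 - e)]
  have h3 : 0 ≤ gleak / (gleak + G) ^ 2 := by positivity
  have h4 : 0 ≤ e / (1 + e) ^ 2 := by positivity
  rw [abs_mul, abs_mul, abs_div, abs_mul, abs_of_pos hα, abs_of_pos hβ,
    abs_of_nonneg h3, abs_of_nonneg h4]
  calc α * |Eg - Eleak| / β * (gleak / (gleak + G) ^ 2) * (e / (1 + e) ^ 2)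
      ≤ α * |Eg - Eleak| / β * (1 / gleak) * (1 / 4) := by gcongr
    _ = α * |Eg - Eleak| / (4 * β * gleak) := by field_simp

/-- the calcium map `ψ` is continuously differentiable on
`(-g_leak, ∞)`, its derivative is bounded by `α|E_g - E_leak|/(4 β g_leak)`
on `[0, ∞)`, and in particular `ψ` is Lipschitz on `[0, ∞)`. -/
theorem psi_derivative_bound (gleak Eleak Eg α β : ℝ)
    (hgl : 0 < gleak) (hα : 0 < α) (hβ : 0 < β) :
    ContDiffOn ℝ 1 (psi α β gleak Eleak Eg) (Set.Ioi (-gleak)) ∧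
    (∀ G, 0 ≤ G →
      |deriv (psi α β gleak Eleak Eg) G| ≤ α * |Eg - Eleak| / (4 * β * gleak)) ∧
    ∃ K : NNReal, LipschitzOnWith K (psi α β gleak Eleak Eg) (Set.Ici 0) := by
  refine ⟨?_, fun G hG => psi_deriv_le_aux gleak Eleak Eg α β G hgl hα hβ hG, ?_⟩
  · have hV : ContDiffOn ℝ 1 (Vss gleak Eleak Eg) (Set.Ioi (-gleak)) := by
      unfold Vss
      refine ContDiffOn.div (by fun_prop) (by fun_prop) ?_
      intro x hx
      have : -gleak < x := hx
      linarith
    unfold psi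
    refine ContDiffOn.div contDiffOn_const
      (contDiffOn_const.add (hV.neg.div_const β).exp) ?_
    intro x _
    positivity
  · refine ⟨(α * |Eg - Eleak| / (4 * β * gleak)).toNNReal,
      (convex_Ici 0).lipschitzOnWith_of_nnnorm_deriv_le ?_ ?_⟩
    · intro x hx
      have hx' : (0 : ℝ) ≤ x := hx
      exact (psi_hasDerivAt_aux gleak Eleak Eg α β x hβ (by linarith)).differentiableAt
    · intro x hx
      rw [← NNReal.coe_le_coe, coe_nnnorm, Real.norm_eq_abs,
        Real.coe_toNNReal _ (by positivity)]
      exact psi_deriv_le_aux gleak Eleak Eg α β x hgl hα hβ hx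
end

section
/- Assume c ∈ ℝⁿ has nonnegative entries with c ≠ 0, g_leak > 0, E_g > E_leak, α, β > 0, and ψ(0) < [Ca]_target < α, where ψ(G) = α/(1 + exp(−V_ss(G)/β)) and V_ss(G) = (G·E_g + g_leak·E_leak)/(g_leak + G). Then for every k_G > 0 and γ_G > 0, the closed-loop system ṁ = (L − Ω_m)m + B·u, ġ = S·m − Ω_g·g, u̇ = k_G·([Ca]_target − ψ(cᵀg)) − γ_G·u has exactly one equilibrium (m*, g*, u*) with u* ≥ 0, and this equilibrium satisfies u* > 0 and m*, g* componentwise nonnegative, with m* = (Ω_m − L)⁻¹B·u* and g* = Ω_g⁻¹S·m*. -/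
theorem aux_Mpos {n : ℕ} (L : Matrix (Fin n) (Fin n) ℝ)
    (hL_off : ∀ i j, i ≠ j → 0 ≤ L i j)
    (hL_col : ∀ j, ∑ i, L i j = 0)
    (ωm : Fin n → ℝ) (hωm : ∀ i, 0 < ωm i) (x : Fin n → ℝ)
    (hx : ∀ i, 0 ≤ (Matrix.diagonal ωm - L).mulVec x i) : ∀ i, 0 ≤ x i := by
  by_contra! hneg
  obtain ⟨i0, hi0⟩ := hneg
  set M := Matrix.diagonal ωm - L with hM
  set N : Finset (Fin n) := Finset.univ.filter (fun i => x i < 0) with hN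
  have hoff : ∀ i j, i ≠ j → M i j ≤ 0 := by
    intro i j hij
    simp [hM, Matrix.diagonal_apply_ne _ hij, hL_off i j hij]
  have hcol : ∀ j, ∑ i, M i j = ωm j := by
    intro j
    simp [hM, Finset.sum_sub_distrib, hL_col, Matrix.diagonal_apply]
  have h1 : 0 ≤ ∑ i ∈ N, M.mulVec x i := Finset.sum_nonneg (fun i _ => hx i)
  have h2 : ∑ i ∈ N, M.mulVec x i = ∑ j, (∑ i ∈ N, M i j) * x j := by
    simp only [Matrix.mulVec, dotProduct, Finset.sum_mul]
    exact Finset.sum_comm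
  have h3 : ∀ j, x j < 0 → (∑ i ∈ N, M i j) * x j < 0 := by
    intro j hj
    have : ∑ i, M i j ≤ ∑ i ∈ N, M i j := by
      rw [← Finset.sum_add_sum_compl N]
      have : ∑ i ∈ Nᶜ, M i j ≤ 0 := by
        apply Finset.sum_nonpos
        intro i hi
        apply hoff
        rintro rfl
        simp [hN] at hi
        linarith
      linarith
    rw [hcol] at this
    exact mul_neg_of_pos_of_neg (lt_of_lt_of_le (hωm j) this) hj
  have h4 : ∀ j, 0 ≤ x j → (∑ i ∈ N, M i j) * x j ≤ 0 := by
    intro j hj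
    apply mul_nonpos_of_nonpos_of_nonneg _ hj
    apply Finset.sum_nonpos
    intro i hi
    apply hoff
    rintro rfl
    simp [hN] at hi
    linarith
  have h5 : ∑ j, (∑ i ∈ N, M i j) * x j < ∑ _j : Fin n, (0 : ℝ) := by
    apply Finset.sum_lt_sum
    · intro j _
      rcases lt_or_ge (x j) 0 with h | h
      · exact (h3 j h).le
      · exact h4 j h
    · exact ⟨i0, Finset.mem_univ _, h3 i0 hi0⟩
  simp only [Finset.sum_const_zero] at h5
  linarith

theorem aux_inj {n : ℕ} (L : Matrix (Fin n) (Fin n) ℝ)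
    (hL_off : ∀ i j, i ≠ j → 0 ≤ L i j)
    (hL_col : ∀ j, ∑ i, L i j = 0)
    (ωm : Fin n → ℝ) (hωm : ∀ i, 0 < ωm i) :
    IsUnit (Matrix.diagonal ωm - L) := by
  rw [← Matrix.mulVec_injective_iff_isUnit]
  intro x y hxy
  have hxy : (Matrix.diagonal ωm - L).mulVec x = (Matrix.diagonal ωm - L).mulVec y := hxy
  have h1 := aux_Mpos L hL_off hL_col ωm hωm (x - y)
    (by intro i; rw [Matrix.mulVec_sub, hxy]; simp)
  have h2 := aux_Mpos L hL_off hL_col ωm hωm (y - x)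
    (by intro i; rw [Matrix.mulVec_sub, hxy]; simp)
  ext i
  have a := h1 i
  have b := h2 i
  simp only [Pi.sub_apply] at a b
  linarith

theorem aux_psi_mono (α β gleak Eleak Eg : ℝ) (hgl : 0 < gleak) (hα : 0 < α) (hβ : 0 < β)
    (hE : Eleak < Eg) (x y : ℝ) (hx : 0 ≤ x) (hxy : x ≤ y) :
    psi α β gleak Eleak Eg x ≤ psi α β gleak Eleak Eg y := by
  have hV : Vss gleak Eleak Eg x ≤ Vss gleak Eleak Eg y := by
    unfold Vss
    rw [div_le_div_iff₀ (by linarith) (by linarith)]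
    have := mul_nonneg (mul_nonneg hgl.le (sub_nonneg.2 hxy)) (sub_nonneg.2 hE.le)
    nlinarith
  unfold psi
  gcongr

theorem aux_psi_pos (α β gleak Eleak Eg x : ℝ) (hα : 0 < α) :
    0 < psi α β gleak Eleak Eg x := by
  unfold psi
  positivity

theorem aux_psi_cont (α β gleak Eleak Eg κ : ℝ) (hgl : 0 < gleak) (hκ : 0 ≤ κ) :
    ContinuousOn (fun u => psi α β gleak Eleak Eg (κ * u)) (Set.Ici 0) := by
  unfold psi Vss
  apply ContinuousOn.div continuousOn_const
  · apply ContinuousOn.add continuousOn_const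
    apply ContinuousOn.rexp
    apply ContinuousOn.div_const
    apply ContinuousOn.neg
    apply ContinuousOn.div (by fun_prop) (by fun_prop)
    intro u hu
    have := mul_nonneg hκ (Set.mem_Ici.1 hu)
    linarith
  · intro u _
    positivity

/-- existence and uniqueness of the nonnegative closed-loop
equilibrium of the globally controlled dendritic trafficking model. -/
theorem unique_nonnegative_equilibrium
    {n : ℕ} (hn : 0 < n)
    (L : Matrix (Fin n) (Fin n) ℝ)
    (hL_off : ∀ i j, i ≠ j → 0 ≤ L i j)
    (hL_col : ∀ j, ∑ i, L i j = 0)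
    (hL_sym : ∀ i j, i ≠ j → (L i j ≠ 0 ↔ L j i ≠ 0))
    (hL_conn : ∀ i j : Fin n, i ≠ j → Relation.TransGen (fun a b => 0 < L b a) i j)
    (ωm ωg s : Fin n → ℝ)
    (hωm : ∀ i, 0 < ωm i) (hωg : ∀ i, 0 < ωg i) (hs : ∀ i, 0 < s i)
    (c : Fin n → ℝ) (hc : ∀ i, 0 ≤ c i) (hc0 : c ≠ 0)
    (γG kG gleak α β Eleak Eg CaT : ℝ)
    (hγ : 0 < γG) (hkG : 0 < kG) (hgl : 0 < gleak) (hα : 0 < α) (hβ : 0 < β)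
    (hE : Eleak < Eg)
    (hCa_lo : psi α β gleak Eleak Eg 0 < CaT) (hCa_hi : CaT < α) :
    ∃ (mstar gstar : Fin n → ℝ) (ustar : ℝ),
      -- (m*, g*, u*) is an equilibrium with u* ≥ 0
      ((L - Matrix.diagonal ωm).mulVec mstar
          + ustar • (Pi.single (⟨0, hn⟩ : Fin n) 1 : Fin n → ℝ) = 0 ∧
       (∀ i, s i * mstar i - ωg i * gstar i = 0) ∧
       kG * (CaT - psi α β gleak Eleak Eg (∑ i, c i * gstar i)) - γG * ustar = 0 ∧
       0 ≤ ustar) ∧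
      -- it satisfies u* > 0, m*, g* ≥ 0, m* = (Ωm - L)⁻¹ B u*, g* = Ωg⁻¹ S m*
      (0 < ustar ∧ (∀ i, 0 ≤ mstar i) ∧ (∀ i, 0 ≤ gstar i) ∧
       mstar = ustar • (Matrix.diagonal ωm - L)⁻¹.mulVec
                 (Pi.single (⟨0, hn⟩ : Fin n) 1 : Fin n → ℝ) ∧
       gstar = ((Matrix.diagonal ωg)⁻¹ * Matrix.diagonal s).mulVec mstar) ∧
      -- and it is the only equilibrium with u* ≥ 0
      (∀ (m' g' : Fin n → ℝ) (u' : ℝ),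
        (L - Matrix.diagonal ωm).mulVec m'
            + u' • (Pi.single (⟨0, hn⟩ : Fin n) 1 : Fin n → ℝ) = 0 →
        (∀ i, s i * m' i - ωg i * g' i = 0) →
        kG * (CaT - psi α β gleak Eleak Eg (∑ i, c i * g' i)) - γG * u' = 0 →
        0 ≤ u' →
        m' = mstar ∧ g' = gstar ∧ u' = ustar) := by
  have hU := aux_inj L hL_off hL_col ωm hωm
  set M := Matrix.diagonal ωm - L with hM
  have hdet : IsUnit M.det := (Matrix.isUnit_iff_isUnit_det M).1 hU
  set e : Fin n → ℝ := Pi.single (⟨0, hn⟩ : Fin n) 1 with he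
  set w : Fin n → ℝ := M⁻¹.mulVec e with hw
  have hMw : M.mulVec w = e := by
    rw [hw, Matrix.mulVec_mulVec, Matrix.mul_nonsing_inv _ hdet, Matrix.one_mulVec]
  have hLM : L - Matrix.diagonal ωm = -M := by rw [hM]; abel
  have hw0 : ∀ i, 0 ≤ w i := by
    apply aux_Mpos L hL_off hL_col ωm hωm
    intro i
    rw [← hM, hMw, he]
    by_cases h : i = ⟨0, hn⟩
    · subst h; simp
    · simp [Pi.single_eq_of_ne h]
  set κ : ℝ := ∑ i, c i * (s i * w i / ωg i) with hκdef
  have hκ : 0 ≤ κ := Finset.sum_nonneg fun i _ =>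
    mul_nonneg (hc i) (div_nonneg (mul_nonneg (hs i).le (hw0 i)) (hωg i).le)
  have hsum : ∀ u : ℝ, ∑ i, c i * (s i * (u * w i) / ωg i) = κ * u := by
    intro u
    rw [hκdef, Finset.sum_mul]
    exact Finset.sum_congr rfl fun i _ => by ring
  have hCa : 0 < CaT := (aux_psi_pos α β gleak Eleak Eg 0 hα).trans hCa_lo
  set f : ℝ → ℝ := fun u => kG * (CaT - psi α β gleak Eleak Eg (κ * u)) - γG * u with hf
  have hfc : ContinuousOn f (Set.Ici 0) := by
    apply ContinuousOn.sub
    · exact continuousOn_const.mul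
        (continuousOn_const.sub (aux_psi_cont α β gleak Eleak Eg κ hgl hκ))
    · fun_prop
  have hanti : ∀ u v, 0 ≤ u → u < v → f v < f u := by
    intro u v hu huv
    have h1 := aux_psi_mono α β gleak Eleak Eg hgl hα hβ hE (κ * u) (κ * v)
      (mul_nonneg hκ hu) (mul_le_mul_of_nonneg_left huv.le hκ)
    have h2 := mul_le_mul_of_nonneg_left h1 hkG.le
    have h3 := mul_lt_mul_of_pos_left huv hγ
    simp only [hf]
    linarith
  have hf0 : 0 < f 0 := by
    simp only [hf, mul_zero, sub_zero]
    exact mul_pos hkG (sub_pos.2 hCa_lo)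
  set U := kG * CaT / γG with hUdef
  have hU0 : 0 ≤ U := by positivity
  have hfU : f U ≤ 0 := by
    have h1 : γG * U = kG * CaT := by rw [hUdef]; field_simp
    have h2 := mul_pos hkG (aux_psi_pos α β gleak Eleak Eg (κ * U) hα)
    simp only [hf, h1]
    linarith
  obtain ⟨u, hu, hfu⟩ := intermediate_value_Icc' hU0
    (hfc.mono Set.Icc_subset_Ici_self) (show (0 : ℝ) ∈ Set.Icc (f U) (f 0) from ⟨hfU, hf0.le⟩)
  have hupos : 0 < u := by
    rcases hu.1.lt_or_eq with h | h
    · exact h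
    · rw [← h] at hfu; linarith
  refine ⟨u • w, fun i => s i * (u * w i) / ωg i, u, ⟨?_, ?_, ?_, hu.1⟩,
    ⟨hupos, ?_, ?_, rfl, ?_⟩, ?_⟩
  · rw [hLM, Matrix.neg_mulVec, Matrix.mulVec_smul, hMw]; simp
  · intro i
    have := (hωg i).ne'
    simp only [Pi.smul_apply, smul_eq_mul]
    field_simp
    ring
  · simp only [hsum]
    exact hfu
  · intro i
    exact mul_nonneg hu.1 (hw0 i)
  · intro i
    exact div_nonneg (mul_nonneg (hs i).le (mul_nonneg hu.1 (hw0 i))) (hωg i).le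
  · have hinv : (Matrix.diagonal ωg)⁻¹ = Matrix.diagonal (fun i => (ωg i)⁻¹) := by
      apply Matrix.inv_eq_right_inv
      rw [Matrix.diagonal_mul_diagonal, ← Matrix.diagonal_one]
      congr 1
      ext i
      exact mul_inv_cancel₀ (hωg i).ne'
    rw [hinv, Matrix.diagonal_mul_diagonal]
    ext i
    rw [Matrix.mulVec_diagonal]
    simp only [Pi.smul_apply, smul_eq_mul]
    ring
  · intro m' g' u' h1 h2 h3 h4
    have hm : m' = u' • w := by
      rw [hLM, Matrix.neg_mulVec] at h1
      have h5 : M.mulVec m' = u' • e := by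
        rw [neg_add_eq_zero] at h1
        exact h1
      rw [hw, ← Matrix.mulVec_smul, ← h5, Matrix.mulVec_mulVec,
        Matrix.nonsing_inv_mul _ hdet, Matrix.one_mulVec]
    have hg : g' = fun i => s i * (u' * w i) / ωg i := by
      ext i
      have h6 := h2 i
      rw [hm] at h6
      simp only [Pi.smul_apply, smul_eq_mul] at h6
      rw [eq_div_iff (hωg i).ne']
      linarith
    have hfu' : f u' = 0 := by
      rw [hg] at h3
      simp only [hsum] at h3
      exact h3
    have huu : u' = u := by
      rcases lt_trichotomy u' u with h | h | h
      · have := hanti _ _ h4 h; linarith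
      · exact h
      · have := hanti _ _ hu.1 h; linarith
    subst huu
    exact ⟨hm, hg, rfl⟩
end

section
/- Let a, σ, λ_g, γ, p, θ be strictly positive real numbers and suppose ρ_g > 0 and σ²·ρ_g/(a·λ_g) < ρ_m < γ·a/p². Then there exists k̄ > 0 such that for every 0 < k ≤ k̄ the symmetric 3×3 matrix with diagonal entries (ρ_m·a/2, ρ_g·λ_g, γ), entry −(ρ_g/2)·σ in positions (1,2) and (2,1), entry −(ρ_m/2)·p in positions (1,3) and (3,1), and entry −(k/2)·θ in positions (2,3) and (3,2), is positive definite. -/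
/-- the Sylvester-criterion matrix of the Lyapunov analysis is
positive definite for all sufficiently small feedback gains `k`. -/
theorem sylvester_matrix_posdef
    (a σ lamg γ p θ ρg ρm : ℝ)
    (ha : 0 < a) (hσ : 0 < σ) (hlamg : 0 < lamg) (hγ : 0 < γ)
    (hp : 0 < p) (hθ : 0 < θ) (hρg : 0 < ρg)
    (hlow : σ ^ 2 * ρg / (a * lamg) < ρm) (hhigh : ρm < γ * a / p ^ 2) :
    ∃ kbar : ℝ, 0 < kbar ∧ ∀ k : ℝ, 0 < k → k ≤ kbar →
      (!![ρm * a / 2,      -(ρg / 2) * σ, -(ρm / 2) * p;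
          -(ρg / 2) * σ,   ρg * lamg,       -(k / 2) * θ;
          -(ρm / 2) * p,   -(k / 2) * θ,  γ] : Matrix (Fin 3) (Fin 3) ℝ).PosDef := by
  have hρm : 0 < ρm := lt_trans (by positivity) hlow
  have h1 : σ ^ 2 * ρg < ρm * (a * lamg) := (div_lt_iff₀ (by positivity)).1 hlow
  have h2 : ρm * p ^ 2 < γ * a := (lt_div_iff₀ (by positivity)).1 hhigh
  obtain ⟨B, hB⟩ : ∃ B, B = ρg * lamg - ρg ^ 2 * σ ^ 2 / (ρm * a) := ⟨_, rfl⟩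
  obtain ⟨C, hC⟩ : ∃ C, C = γ - ρm * p ^ 2 / a := ⟨_, rfl⟩
  have hB0 : 0 < B := by
    rw [hB, sub_pos, div_lt_iff₀ (by positivity)]
    nlinarith [mul_lt_mul_of_pos_left h1 hρg]
  have hC0 : 0 < C := by
    rw [hC, sub_pos, div_lt_iff₀ ha]
    exact h2
  refine ⟨min B C / θ, by positivity, fun k hk hkb => ?_⟩
  have hkθ : k * θ ≤ min B C := (le_div_iff₀ hθ).1 hkb
  have hkB : k * θ ≤ B := hkθ.trans (min_le_left _ _)
  have hkC : k * θ ≤ C := hkθ.trans (min_le_right _ _)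
  have hkp : 0 < k * θ := by positivity
  have key : ∀ x y z : ℝ, (x ≠ 0 ∨ y ≠ 0 ∨ z ≠ 0) →
      0 < ρm * a / 2 * x ^ 2 + ρg * lamg * y ^ 2 + γ * z ^ 2
        - ρg * σ * x * y - ρm * p * x * z - k * θ * y * z := by
    intro x y z h
    have e : ρm * a / 2 * x ^ 2 + ρg * lamg * y ^ 2 + γ * z ^ 2
        - ρg * σ * x * y - ρm * p * x * z - k * θ * y * z
        = ρm * a / 4 * (x - 2 * ρg * σ / (ρm * a) * y) ^ 2
          + ρm * a / 4 * (x - 2 * p / a * z) ^ 2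
          + (B - k * θ / 2) * y ^ 2 + (C - k * θ / 2) * z ^ 2
          + k * θ / 2 * (y - z) ^ 2 := by
      rw [hB, hC]
      field_simp
      ring
    have b1 : 0 < B - k * θ / 2 := by linarith
    have c1 : 0 < C - k * θ / 2 := by linarith
    rw [e]
    by_cases hy : y = 0
    · by_cases hz : z = 0
      · have hx : x ≠ 0 := by
          rcases h with h | h | h
          · exact h
          · exact absurd hy h
          · exact absurd hz h
        subst hy hz
        simp only [mul_zero, sub_zero]
        positivity
      · have : 0 < (C - k * θ / 2) * z ^ 2 := by positivity
        have : 0 ≤ (B - k * θ / 2) * y ^ 2 := by positivity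
        positivity
    · have : 0 < (B - k * θ / 2) * y ^ 2 := by positivity
      have : 0 ≤ (C - k * θ / 2) * z ^ 2 := by positivity
      positivity
  refine Matrix.PosDef.of_dotProduct_mulVec_pos ?_ ?_
  · ext i j
    fin_cases i <;> fin_cases j <;> simp [Matrix.conjTranspose]
  · intro v hv
    have hne : v 0 ≠ 0 ∨ v 1 ≠ 0 ∨ v 2 ≠ 0 := by
      by_contra! hc
      apply hv
      ext i
      fin_cases i
      · exact hc.1
      · exact hc.2.1
      · exact hc.2.2
    refine (key _ _ _ hne).trans_eq ?_
    simp [Matrix.mulVec, dotProduct, Fin.sum_univ_three]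
    ring
end

section
/- Consider the linear time-varying system δṁ = (L − D(t))·δm + B·δu, δġ = S·δm − Ω_g·δg, δu̇ = −k·θ(t)ᵀδg − γ_G·δu, where D(t) is a continuous diagonal-matrix-valued function whose diagonal entries satisfy D_ii(t) ≥ a > 0 for all t, and θ : [0, ∞) → ℝⁿ is continuous with ‖θ(t)‖ ≤ θ̄ for all t. Then there exists k̄ > 0 such that for every 0 < k ≤ k̄ there are constants M ≥ 1 and λ > 0 with ‖(δm(t), δg(t), δu(t))‖ ≤ M·e^{−λt}·‖(δm(0), δg(0), δu(0))‖ for every solution and every t ≥ 0 (uniform exponential stability of the linearized widened reduced system). -/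
/-- The absolute value of a differentiable function has a right derivative. -/
theorem abs_right_deriv {x : ℝ → ℝ} {x' t : ℝ} (h : HasDerivAt x x' t) :
    ∃ σ : ℝ, |σ| ≤ 1 ∧ σ * x t = |x t| ∧
      HasDerivWithinAt (fun z => |x z|) (σ * x') (Set.Ici t) t := by
  rcases lt_trichotomy (x t) 0 with hx | hx | hx
  · refine ⟨-1, by simp, by rw [abs_of_neg hx]; ring, ?_⟩
    have := (hasDerivAt_abs_neg hx).comp t h
    exact this.hasDerivWithinAt
  · have key : HasDerivWithinAt (fun z => |x z|) |x'| (Set.Ici t) t := by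
      rw [hasDerivWithinAt_iff_isLittleO]
      have h2 := hasDerivWithinAt_iff_isLittleO.1 (h.hasDerivWithinAt (s := Set.Ici t))
      refine Asymptotics.IsBigO.trans_isLittleO ?_ h2
      refine Asymptotics.IsBigO.of_bound 1 ?_
      filter_upwards [self_mem_nhdsWithin] with z hz
      have hz' : 0 ≤ z - t := sub_nonneg.2 hz
      simp only [hx, abs_zero, sub_zero, smul_eq_mul, Real.norm_eq_abs, one_mul]
      have := abs_abs_sub_abs_le_abs_sub (x z) ((z - t) * x')
      rwa [abs_mul, abs_of_nonneg hz'] at this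
    rcases le_total 0 x' with h0 | h0
    · refine ⟨1, by simp, by simp [hx], ?_⟩
      rw [abs_of_nonneg h0] at key
      simpa using key
    · refine ⟨-1, by simp, by simp [hx], ?_⟩
      rw [abs_of_nonpos h0] at key
      simpa using key
  · refine ⟨1, by simp, by rw [abs_of_pos hx]; ring, ?_⟩
    have := (hasDerivAt_abs_pos hx).comp t h
    exact this.hasDerivWithinAt

theorem sgn_mul_le {σ y : ℝ} (h : |σ| ≤ 1) : σ * y ≤ |y| := by
  calc σ * y ≤ |σ * y| := le_abs_self _
    _ = |σ| * |y| := abs_mul _ _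
    _ ≤ 1 * |y| := by gcongr
    _ = |y| := one_mul _

theorem decay_of_right_deriv {V V' : ℝ → ℝ} {lam : ℝ}
    (hd : ∀ t, 0 ≤ t → HasDerivWithinAt V (V' t) (Set.Ici t) t)
    (hc : ContinuousOn V (Set.Ici 0))
    (hb : ∀ t, 0 ≤ t → V' t ≤ -lam * V t) (t : ℝ) (ht : 0 ≤ t) :
    V t ≤ V 0 * Real.exp (-lam * t) := by
  have := le_gronwallBound_of_liminf_deriv_right_le (f := V) (f' := V') (δ := V 0)
    (K := -lam) (ε := 0) (a := 0) (b := t) (hc.mono Set.Icc_subset_Ici_self)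
    (fun x hx r hr => (hd x hx.1).liminf_right_slope_le hr) le_rfl
    (fun x hx => by simpa using hb x hx.1) t ⟨ht, le_rfl⟩
  simpa [gronwallBound_ε0] using this

theorem transport_bound {n : ℕ} (hn : 0 < n)
    (L : Matrix (Fin n) (Fin n) ℝ)
    (hL_off : ∀ i j, i ≠ j → 0 ≤ L i j)
    (hL_col : ∀ j, ∑ i, L i j = 0) (a : ℝ) (d m σ : Fin n → ℝ) (u : ℝ)
    (hd : ∀ i, a ≤ d i) (h1 : ∀ i, |σ i| ≤ 1) (h2 : ∀ i, σ i * m i = |m i|) :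
    ∑ i, σ i * (((L - Matrix.diagonal d).mulVec m
      + u • (Pi.single (⟨0, hn⟩ : Fin n) 1 : Fin n → ℝ)) i) ≤ -a * ∑ i, |m i| + |u| := by
  have e : ∀ i, σ i * (((L - Matrix.diagonal d).mulVec m
      + u • (Pi.single (⟨0, hn⟩ : Fin n) 1 : Fin n → ℝ)) i)
      = ∑ j, σ i * (L i j * m j) - d i * |m i|
        + (Pi.single (⟨0, hn⟩ : Fin n) (σ ⟨0, hn⟩ * u) : Fin n → ℝ) i := by
    intro i
    rw [← h2 i, ← Finset.mul_sum, Matrix.sub_mulVec]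
    simp only [Pi.add_apply, Pi.sub_apply, Pi.smul_apply, Matrix.mulVec_diagonal, smul_eq_mul]
    simp only [Matrix.mulVec, dotProduct]
    by_cases hi : i = ⟨0, hn⟩
    · subst hi; simp; ring
    · simp [hi]; ring
  have hL : ∑ i, ∑ j, σ i * (L i j * m j) ≤ 0 := by
    calc ∑ i, ∑ j, σ i * (L i j * m j) ≤ ∑ i, ∑ j, L i j * |m j| := by
          refine Finset.sum_le_sum fun i _ => Finset.sum_le_sum fun j _ => ?_
          by_cases hij : i = j
          · subst hij; rw [← h2 i]; apply le_of_eq; ring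
          · have := sgn_mul_le (y := L i j * m j) (h1 i)
            rwa [abs_mul, abs_of_nonneg (hL_off i j hij)] at this
      _ = 0 := by
          rw [Finset.sum_comm]
          simp [← Finset.sum_mul, hL_col]
  have hD : a * ∑ i, |m i| ≤ ∑ i, d i * |m i| := by
    rw [Finset.mul_sum]
    exact Finset.sum_le_sum fun i _ => mul_le_mul_of_nonneg_right (hd i) (abs_nonneg _)
  rw [Finset.sum_congr rfl fun i _ => e i, Finset.sum_add_distrib, Finset.sum_sub_distrib]
  have hu := sgn_mul_le (y := u) (h1 ⟨0, hn⟩)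
  simp only [Finset.sum_pi_single', Finset.sum_pi_single, Finset.mem_univ, if_true] at *
  linarith

/-- uniform exponential stability of the linearized widened
reduced system, for sufficiently small feedback gain `k`. -/
theorem linearized_widened_system_stability
    {n : ℕ} (hn : 0 < n)
    (L : Matrix (Fin n) (Fin n) ℝ)
    (hL_off : ∀ i j, i ≠ j → 0 ≤ L i j)
    (hL_col : ∀ j, ∑ i, L i j = 0)
    (hL_sym : ∀ i j, i ≠ j → (L i j ≠ 0 ↔ L j i ≠ 0))
    (hL_conn : ∀ i j : Fin n, i ≠ j → Relation.TransGen (fun a b => 0 < L b a) i j)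
    (ωg s : Fin n → ℝ) (hωg : ∀ i, 0 < ωg i) (hs : ∀ i, 0 < s i)
    (γG : ℝ) (hγ : 0 < γG)
    (a : ℝ) (ha : 0 < a)
    (D : ℝ → Fin n → ℝ) (hD_cont : ContinuousOn D (Set.Ici 0))
    (hD_lb : ∀ t, 0 ≤ t → ∀ i, a ≤ D t i)
    (θbar : ℝ)
    (θ : ℝ → Fin n → ℝ) (hθ_cont : ContinuousOn θ (Set.Ici 0))
    (hθ_bd : ∀ t, 0 ≤ t → ‖θ t‖ ≤ θbar) :
    ∃ kbar : ℝ, 0 < kbar ∧ ∀ k : ℝ, 0 < k → k ≤ kbar →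
      ∃ M : ℝ, 1 ≤ M ∧ ∃ lam : ℝ, 0 < lam ∧
        ∀ (δm δg : ℝ → Fin n → ℝ) (δu : ℝ → ℝ),
          (∀ t, 0 ≤ t → HasDerivAt δm
            ((L - Matrix.diagonal (D t)).mulVec (δm t)
              + δu t • (Pi.single (⟨0, hn⟩ : Fin n) 1 : Fin n → ℝ)) t) →
          (∀ t, 0 ≤ t → HasDerivAt δg (fun i => s i * δm t i - ωg i * δg t i) t) →
          (∀ t, 0 ≤ t → HasDerivAt δu
            (-k * (∑ i, θ t i * δg t i) - γG * δu t) t) →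
          ∀ t, 0 ≤ t →
            ‖(δm t, δg t, δu t)‖ ≤
              M * Real.exp (-lam * t) * ‖(δm 0, δg 0, δu 0)‖ := by
  have hθ0 : 0 ≤ θbar := (norm_nonneg _).trans (hθ_bd 0 le_rfl)
  obtain ⟨w, hw, hwω⟩ : ∃ w : ℝ, 0 < w ∧ ∀ i, w ≤ ωg i := by
    obtain ⟨i0, _, hi0⟩ := Finset.exists_min_image (Finset.univ : Finset (Fin n)) ωg
      ⟨⟨0, hn⟩, Finset.mem_univ _⟩
    exact ⟨ωg i0, hωg i0, fun i => hi0 i (Finset.mem_univ _)⟩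
  obtain ⟨S, hS⟩ : ∃ S, S = ∑ i, s i := ⟨_, rfl⟩
  have hSi : ∀ i, s i ≤ S := fun i => by
    rw [hS]; exact Finset.single_le_sum (fun j _ => (hs j).le) (Finset.mem_univ i)
  have hS0 : 0 < S := (hs ⟨0, hn⟩).trans_le (hSi _)
  obtain ⟨p, hp⟩ : ∃ p, p = 2 * S / a := ⟨_, rfl⟩
  have hp0 : 0 < p := by rw [hp]; positivity
  have hpa : p * a = 2 * S := by rw [hp]; field_simp
  obtain ⟨r, hr⟩ : ∃ r, r = 2 * p / γG := ⟨_, rfl⟩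
  have hr0 : 0 < r := by rw [hr]; positivity
  have hrγ : r * γG = 2 * p := by rw [hr]; field_simp
  refine ⟨w / (2 * r * (θbar + 1)), by positivity, fun k hk hkb => ?_⟩
  have hkr : r * (k * θbar) ≤ w / 2 := by
    rw [le_div_iff₀ (by positivity)] at hkb
    nlinarith [mul_pos hr0 hk]
  obtain ⟨c, hc0, hcp, hc1, hcr⟩ : ∃ c : ℝ, 0 < c ∧ c ≤ p ∧ c ≤ 1 ∧ c ≤ r :=
    ⟨min p (min 1 r), by positivity, min_le_left _ _, (min_le_right _ _).trans (min_le_left _ _),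
      (min_le_right _ _).trans (min_le_right _ _)⟩
  obtain ⟨lam, hl0, hla, hlw, hlγ⟩ : ∃ l : ℝ, 0 < l ∧ l ≤ a / 2 ∧ l ≤ w / 2 ∧ l ≤ γG / 2 :=
    ⟨min (a / 2) (min (w / 2) (γG / 2)), by positivity, min_le_left _ _,
      (min_le_right _ _).trans (min_le_left _ _), (min_le_right _ _).trans (min_le_right _ _)⟩
  refine ⟨max 1 ((p * n + n + r) / c), le_max_left _ _, lam, hl0, ?_⟩
  intro m g u hm hg hu t ht
  have hmi : ∀ t, 0 ≤ t → ∀ i, HasDerivAt (fun z => m z i) _ t :=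
    fun t ht i => hasDerivAt_pi.1 (hm t ht) i
  have hgi : ∀ t, 0 ≤ t → ∀ i, HasDerivAt (fun z => g z i) (s i * m t i - ωg i * g t i) t :=
    fun t ht i => hasDerivAt_pi.1 (hg t ht) i
  let V : ℝ → ℝ := fun t => p * ∑ i, |m t i| + ∑ i, |g t i| + r * |u t|
  have hV : ∀ t, 0 ≤ t → ∃ v', HasDerivWithinAt V v' (Set.Ici t) t ∧ v' ≤ -lam * V t := by
    intro t ht
    choose σ hσ1 hσ2 hσ3 using fun i => abs_right_deriv (hmi t ht i)
    choose τ hτ1 hτ2 hτ3 using fun i => abs_right_deriv (hgi t ht i)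
    obtain ⟨ρ, hρ1, hρ2, hρ3⟩ := abs_right_deriv (hu t ht)
    refine ⟨_, (((HasDerivWithinAt.fun_sum (u := Finset.univ) fun i _ => hσ3 i).const_mul p).add
      (HasDerivWithinAt.fun_sum (u := Finset.univ) fun i _ => hτ3 i)).add (hρ3.const_mul r), ?_⟩
    have b1 := transport_bound hn L hL_off hL_col a (D t) (m t) σ (u t) (hD_lb t ht) hσ1 hσ2
    have b2 : ∑ i, τ i * (s i * m t i - ωg i * g t i) ≤ S * ∑ i, |m t i| - w * ∑ i, |g t i| := by
      rw [Finset.mul_sum, Finset.mul_sum, ← Finset.sum_sub_distrib]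
      refine Finset.sum_le_sum fun i _ => ?_
      have h1 := sgn_mul_le (y := m t i) (hτ1 i)
      have h2 := mul_le_mul_of_nonneg_left h1 (hs i).le
      have h3 := mul_le_mul_of_nonneg_right (hSi i) (abs_nonneg (m t i))
      have h4 := mul_le_mul_of_nonneg_right (hwω i) (abs_nonneg (g t i))
      have h5 : τ i * (s i * m t i - ωg i * g t i)
        = s i * (τ i * m t i) - ωg i * |g t i| := by rw [← hτ2 i]; ring
      linarith
    have b3 : ρ * (-k * (∑ i, θ t i * g t i) - γG * u t)
        ≤ k * θbar * ∑ i, |g t i| - γG * |u t| := by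
      have h1 := sgn_mul_le (y := -k * (∑ i, θ t i * g t i)) hρ1
      have h2 : |∑ i, θ t i * g t i| ≤ θbar * ∑ i, |g t i| := by
        rw [Finset.mul_sum]
        refine (Finset.abs_sum_le_sum_abs _ _).trans (Finset.sum_le_sum fun i _ => ?_)
        rw [abs_mul]
        exact mul_le_mul_of_nonneg_right
          ((norm_le_pi_norm (θ t) i).trans (hθ_bd t ht)) (abs_nonneg _)
      rw [abs_mul, abs_neg, abs_of_pos hk] at h1
      have h3 := mul_le_mul_of_nonneg_left h2 hk.le
      have h5 : ρ * (-k * (∑ i, θ t i * g t i) - γG * u t)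
        = ρ * (-k * (∑ i, θ t i * g t i)) - γG * |u t| := by rw [← hρ2]; ring
      linarith
    have c1 := mul_le_mul_of_nonneg_left b1 hp0.le
    have c3 := mul_le_mul_of_nonneg_left b3 hr0.le
    have nA : 0 ≤ ∑ i, |m t i| := Finset.sum_nonneg fun i _ => abs_nonneg _
    have nB : 0 ≤ ∑ i, |g t i| := Finset.sum_nonneg fun i _ => abs_nonneg _
    have nC : 0 ≤ |u t| := abs_nonneg _
    refine (add_le_add (add_le_add c1 b2) c3).trans ?_
    change _ ≤ -lam * (p * ∑ i, |m t i| + ∑ i, |g t i| + r * |u t|)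
    generalize ∑ i, |m t i| = A at *
    generalize ∑ i, |g t i| = B at *
    generalize |u t| = C at *
    have e1 : p * (-a * A + C) + (S * A - w * B) + r * (k * θbar * B - γG * C)
        = -(p * a) * A + p * C + S * A - w * B + r * (k * θbar) * B - (r * γG) * C := by ring
    rw [e1]
    have d1 := mul_le_mul_of_nonneg_right hkr nB
    have d2 := mul_le_mul_of_nonneg_right hla (mul_nonneg hp0.le nA)
    have d3 := mul_le_mul_of_nonneg_right hlw nB
    have d4 := mul_le_mul_of_nonneg_right hlγ (mul_nonneg hr0.le nC)
    have d5 : a / 2 * (p * A) = S * A := by linear_combination (A / 2) * hpa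
    have d6 : γG / 2 * (r * C) = p * C := by linear_combination (C / 2) * hrγ
    rw [hpa, hrγ]
    linarith
  choose! V' hV1 hV2 using hV
  have hVc : ContinuousOn V (Set.Ici 0) := by
    intro t ht
    have h1 : ∀ i, ContinuousAt (fun z => m z i) t := fun i => (hmi t ht i).continuousAt
    have h2 : ∀ i, ContinuousAt (fun z => g z i) t := fun i => (hgi t ht i).continuousAt
    have h3 : ContinuousAt u t := (hu t ht).continuousAt
    apply ContinuousAt.continuousWithinAt
    refine ((continuousAt_const.mul (tendsto_finsetSum _ fun i _ => (h1 i).abs)).add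
      (tendsto_finsetSum _ fun i _ => (h2 i).abs)).add (continuousAt_const.mul h3.abs)
  have hdec := decay_of_right_deriv hV1 hVc hV2 t ht
  have hpi : ∀ x : Fin n → ℝ, ‖x‖ ≤ ∑ i, |x i| := fun x =>
    (pi_norm_le_iff_of_nonneg (Finset.sum_nonneg fun i _ => abs_nonneg _)).2 fun i =>
      Finset.single_le_sum (f := fun i => |x i|) (fun j _ => abs_nonneg _) (Finset.mem_univ i)
  have hpi2 : ∀ x : Fin n → ℝ, ∑ i, |x i| ≤ n * ‖x‖ := fun x => by
    have := Finset.sum_le_card_nsmul Finset.univ (fun i => |x i|) ‖x‖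
      (fun i _ => norm_le_pi_norm x i)
    simpa using this
  have low : c * ‖(m t, g t, u t)‖ ≤ V t := by
    have hA := hpi (m t)
    have hB := hpi (g t)
    have nA := norm_nonneg (m t)
    have nB := norm_nonneg (g t)
    have nC := abs_nonneg (u t)
    have h1 : ‖(m t, g t, u t)‖ ≤ ∑ i, |m t i| + ∑ i, |g t i| + |u t| := by
      rw [Prod.norm_mk, Prod.norm_mk, Real.norm_eq_abs]
      refine max_le (by linarith) (max_le (by linarith) (by linarith))
    have h2 := mul_le_mul_of_nonneg_left h1 hc0.le
    have h3 := mul_le_mul_of_nonneg_right hcp (nA.trans hA)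
    have h4 := mul_le_mul_of_nonneg_right hc1 (nB.trans hB)
    have h5 := mul_le_mul_of_nonneg_right hcr nC
    change _ ≤ p * ∑ i, |m t i| + ∑ i, |g t i| + r * |u t|
    linarith
  have up : V 0 ≤ (p * n + n + r) * ‖(m 0, g 0, u 0)‖ := by
    have h1 : ‖m 0‖ ≤ ‖(m 0, g 0, u 0)‖ := norm_fst_le (m 0, g 0, u 0)
    have h0 : ‖(g 0, u 0)‖ ≤ ‖(m 0, g 0, u 0)‖ := norm_snd_le (m 0, g 0, u 0)
    have h2 : ‖g 0‖ ≤ ‖(m 0, g 0, u 0)‖ := (norm_fst_le (g 0, u 0)).trans h0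
    have h3 : |u 0| ≤ ‖(m 0, g 0, u 0)‖ := (norm_snd_le (g 0, u 0)).trans h0
    have nn : (0 : ℝ) ≤ n := Nat.cast_nonneg n
    have h4 := (hpi2 (m 0)).trans (mul_le_mul_of_nonneg_left h1 nn)
    have h5 := (hpi2 (g 0)).trans (mul_le_mul_of_nonneg_left h2 nn)
    have h6 := mul_le_mul_of_nonneg_left h4 hp0.le
    have h7 := mul_le_mul_of_nonneg_left h3 hr0.le
    change p * ∑ i, |m 0 i| + ∑ i, |g 0 i| + r * |u 0| ≤ _
    linarith
  have hE := Real.exp_pos (-lam * t)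
  calc ‖(m t, g t, u t)‖ ≤ V t / c := by rw [le_div_iff₀ hc0]; linarith
    _ ≤ ((p * n + n + r) * ‖(m 0, g 0, u 0)‖ * Real.exp (-lam * t)) / c := by
      gcongr
      exact hdec.trans (mul_le_mul_of_nonneg_right up hE.le)
    _ = (p * n + n + r) / c * Real.exp (-lam * t) * ‖(m 0, g 0, u 0)‖ := by ring
    _ ≤ _ := by
      gcongr
      exact le_max_right _ _
end
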